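/- Let m ∈ (1,2] and let u, u' ∈ {0,1}^ℕ each contain at least two ones. If sup O(u) < sup O(u') in the lexicographic order and f_u(m) ≥ 2, then f_u(m) < f_{u'}(m). If inf O(u) < inf O(u') in the lexicographic order and g_{u'}(m) ≥ 2, then g_u(m) > g_{u'}(m). -/

import Mathlib

/-- `π_β(u)` for a binary sequence `u = u₁u₂⋯` (indexed from 0). -/
noncomputable def piB (β : ℝ) (u : ℕ → Bool) : ℝ :=
  ∑' k : ℕ, (if u k then (1 : ℝ) else 0) / β ^ (k + 1)

/-- `π_β(u)` for a real digit sequence. -/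
noncomputable def piR (β : ℝ) (u : ℕ → ℝ) : ℝ := ∑' k : ℕ, u k / β ^ (k + 1)

/-- A binary sequence viewed as a real digit sequence. -/
def bR (u : ℕ → Bool) : ℕ → ℝ := fun k => if u k then 1 else 0

/-- `U_β(A)`: sequences with digits in `A` whose `π_β`-value has no other expansion over `A`. -/
def Uset (β : ℝ) (A : Set ℝ) : Set (ℕ → ℝ) :=
  {u | (∀ k, u k ∈ A) ∧ ∀ v : ℕ → ℝ, (∀ k, v k ∈ A) → v ≠ u → piR β v ≠ piR β u}

/-- `𝓛(m) = inf {β > 1 : U_β(m) ∩ {0,1}^ℕ is uncountable}`. -/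
noncomputable def Lval (m : ℝ) : ℝ :=
  sInf {β : ℝ | 1 < β ∧ ¬ (Uset β {0, 1, m} ∩ {v | ∃ u : ℕ → Bool, v = bR u}).Countable}

/-- The shift orbit `O(u)` of an infinite binary word. -/
def orbit (u : ℕ → Bool) : Set (ℕ → Bool) := {v | ∃ k : ℕ, v = fun i => u (i + k)}

/-- Suffixes of `u` preceded by the letter `1`. -/
def orbit1 (u : ℕ → Bool) : Set (ℕ → Bool) :=
  {v | ∃ k : ℕ, u k = true ∧ v = fun i => u (i + k + 1)}

/-- Suffixes of `u` preceded by the letter `0`. -/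
def orbit0 (u : ℕ → Bool) : Set (ℕ → Bool) :=
  {v | ∃ k : ℕ, u k = false ∧ v = fun i => u (i + k + 1)}

open Classical in
/-- The lexicographic supremum of a set of binary sequences (greedy construction);
`⊥ = 0̄` for the empty set. -/
noncomputable def lexSupSeq (S : Set (ℕ → Bool)) : ℕ → Bool
  | n => decide (∃ u ∈ S, (∀ i, i < n → u i = lexSupSeq S i) ∧ u n = true)
  termination_by n => n

open Classical in
/-- The lexicographic infimum of a set of binary sequences (greedy construction);
`⊤ = 1̄` for the empty set. -/
noncomputable def lexInfSeq (S : Set (ℕ → Bool)) : ℕ → Bool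
  | n => decide (¬ ∃ u ∈ S, (∀ i, i < n → u i = lexInfSeq S i) ∧ u n = false)
  termination_by n => n

/-- `sup O(u)`, the lexicographically largest limit of suffixes of `u`. -/
noncomputable def supO (u : ℕ → Bool) : ℕ → Bool := lexSupSeq (orbit u)
/-- `inf O(u)`. -/
noncomputable def infO (u : ℕ → Bool) : ℕ → Bool := lexInfSeq (orbit u)
/-- `sup₀(u)`, the supremum of the suffixes preceded by `0`. -/
noncomputable def sup0 (u : ℕ → Bool) : ℕ → Bool := lexSupSeq (orbit0 u)
/-- `inf₁(u)`, the infimum of the suffixes preceded by `1`. -/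
noncomputable def inf1 (u : ℕ → Bool) : ℕ → Bool := lexInfSeq (orbit1 u)

/-- Strict lexicographic order on infinite binary words. -/
def lexLt (u v : ℕ → Bool) : Prop := ∃ n, (∀ i, i < n → u i = v i) ∧ u n < v n
/-- Lexicographic order on infinite binary words. -/
def lexLe (u v : ℕ → Bool) : Prop := lexLt u v ∨ u = v

/-- `f_u(m)`: the unique `β ≥ 1` with `β·π_β(sup O(u)) = m`. -/
noncomputable def fVal (u : ℕ → Bool) (m : ℝ) : ℝ :=
  sInf {β : ℝ | 1 ≤ β ∧ β * piB β (supO u) = m}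

/-- `g_u(m)`: the unique `β > 1` with `(β-1)(1+π_β(inf O(u))) = m`. -/
noncomputable def gVal (u : ℕ → Bool) (m : ℝ) : ℝ :=
  sInf {β : ℝ | 1 < β ∧ (β - 1) * (1 + piB β (infO u)) = m}

/-- `μ_u`: the unique `m ∈ (1,2]` with `f_u(m) = g_u(m)`. -/
noncomputable def muVal (u : ℕ → Bool) : ℝ :=
  sInf {m : ℝ | 1 < m ∧ m ≤ 2 ∧ fVal u m = gVal u m}

/-- `u` contains at least two ones. -/
def TwoOnes (u : ℕ → Bool) : Prop := ∃ k l, k < l ∧ u k = true ∧ u l = true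

/-- The substitution `L : 0 ↦ 0, 1 ↦ 01` (with `0 = false`, `1 = true`). -/
def Lsub : Bool → List Bool := fun b => if b then [false, true] else [false]
/-- The substitution `M : 0 ↦ 01, 1 ↦ 10`. -/
def Msub : Bool → List Bool := fun b => if b then [true, false] else [false, true]
/-- The substitution `R : 0 ↦ 01, 1 ↦ 1`. -/
def Rsub : Bool → List Bool := fun b => if b then [true] else [false, true]
/-- The identity substitution. -/
def idSub : Bool → List Bool := fun b => [b]
/-- Composition of substitutions: `compSub σ τ = σ ∘ τ` (apply `τ` first). -/
def compSub (σ τ : Bool → List Bool) : Bool → List Bool := fun b => (τ b).flatMap σ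

/-- The monoid `{L,M,R}*` generated by the three substitutions. -/
def LMRstar : Set (Bool → List Bool) :=
  {σ | ∃ l : List (Bool → List Bool),
    (∀ τ ∈ l, τ = Lsub ∨ τ = Msub ∨ τ = Rsub) ∧ σ = l.foldr compSub idSub}

/-- A substitution applied to an infinite word, `σ(u₁)σ(u₂)⋯`. -/
noncomputable def substApply (σ : Bool → List Bool) (u : ℕ → Bool) : ℕ → Bool := fun n =>
  let k := sSup {k : ℕ | (∑ i ∈ Finset.range k, (σ (u i)).length) ≤ n}
  (σ (u k)).getD (n - ∑ i ∈ Finset.range k, (σ (u i)).length) false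

/-- `u` is a limit word of the sequence of substitutions `σseq`. -/
def IsLimitWord (σseq : ℕ → Bool → List Bool) (u : ℕ → Bool) : Prop :=
  ∃ useq : ℕ → ℕ → Bool, useq 0 = u ∧ ∀ n, useq n = substApply (σseq n) (useq (n + 1))

/-- Primitivity of a sequence of substitutions in `{L,M,R}^ℕ`: no tail is constantly `L`
and no tail is constantly `R`. -/
def PrimitiveSeq (σseq : ℕ → Bool → List Bool) : Prop :=
  (¬ ∃ k, ∀ n, k ≤ n → σseq n = Lsub) ∧ ¬ ∃ k, ∀ n, k ≤ n → σseq n = Rsub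

/-- `S_{L,M,R}`: the set of limit words of primitive sequences of substitutions. -/
def Sset : Set (ℕ → Bool) :=
  {u | ∃ σseq : ℕ → Bool → List Bool,
    (∀ n, σseq n = Lsub ∨ σseq n = Msub ∨ σseq n = Rsub) ∧
    PrimitiveSeq σseq ∧ IsLimitWord σseq u}

/-- The word `1 0̄ = 1000⋯`. -/
def w10bar : ℕ → Bool := fun n => decide (n = 0)
/-- The word `0 1̄ = 0111⋯`. -/
def w01bar : ℕ → Bool := fun n => decide (n ≠ 0)
/-- The word `01 0̄ = 01000⋯`. -/
def w010bar : ℕ → Bool := fun n => decide (n = 1)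
/-- The word `10 1̄ = 10111⋯`. -/
def w101bar : ℕ → Bool := fun n => decide (n ≠ 1)
/-- The word `0̄`. -/
def w0bar : ℕ → Bool := fun _ => false
/-- The word `1̄`. -/
def w1bar : ℕ → Bool := fun _ => true

/-- Prepend a letter to an infinite word. -/
def consB (b : Bool) (u : ℕ → Bool) : ℕ → Bool := fun n =>
  match n with
  | 0 => b
  | Nat.succ k => u k

/-- Prepend a finite word to an infinite word. -/
def appendW (w : List Bool) (v : ℕ → Bool) : ℕ → Bool := fun n =>
  if n < w.length then w.getD n false else v (n - w.length)

/-- Extending a prefix of `lexSupSeq S`: every finite prefix is a prefix of an element of `S`. -/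
theorem exists_mem_agrees_lexSupSeq {S : Set (ℕ → Bool)} (hS : S.Nonempty) (n : ℕ) :
    ∃ v ∈ S, ∀ i, i < n → v i = lexSupSeq S i := by
  induction n with
  | zero => exact hS.imp fun v hv => ⟨hv, by simp⟩
  | succ n ih =>
    obtain ⟨v, hv, hvi⟩ := ih
    by_cases h : ∃ w ∈ S, (∀ i, i < n → w i = lexSupSeq S i) ∧ w n = true
    · have hn : lexSupSeq S n = true := by
        rw [lexSupSeq]
        simpa using h
      obtain ⟨w, hw, hwi, hwn⟩ := h
      refine ⟨w, hw, fun i hi => ?_⟩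
      rcases Nat.lt_succ_iff_lt_or_eq.mp hi with hi | rfl
      · exact hwi i hi
      · rw [hwn, hn]
    · have hn : lexSupSeq S n = false := by
        rw [lexSupSeq]
        simpa using h
      refine ⟨v, hv, fun i hi => ?_⟩
      rcases Nat.lt_succ_iff_lt_or_eq.mp hi with hi | rfl
      · exact hvi i hi
      · rw [hn]
        by_contra hvn
        exact h ⟨v, hv, hvi, by simpa using hvn⟩

open Classical in
/-- If `sup O(u)` ends in `1̄` then it is `1̄`. -/
theorem supO_eq_true_of_eventually {u : ℕ → Bool} {N : ℕ}
    (h : ∀ k, N < k → supO u k = true) (n : ℕ) : supO u n = true := by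
  induction n using Nat.strong_induction_on with
  | _ n ih =>
    obtain ⟨v, ⟨k, rfl⟩, hv⟩ :=
      exists_mem_agrees_lexSupSeq (S := orbit u) ⟨u, 0, rfl⟩ (N + n + 2)
    have hone : ∀ i, i ≤ n → u (i + (N + 1 + k)) = true := by
      intro i hi
      have h1 := hv (i + N + 1) (by omega)
      have h2 := h (i + N + 1) (by omega)
      rw [supO] at h2
      rw [h2] at h1
      rw [← h1]
      congr 1
      omega
    rw [supO, lexSupSeq]
    refine decide_eq_true ⟨fun i => u (i + (N + 1 + k)), ⟨_, rfl⟩, fun i hi => ?_, hone n le_rfl⟩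
    have := ih i hi
    rw [supO] at this
    rw [this]
    exact hone i hi.le

open Classical in
theorem supO_not (u : ℕ → Bool) : supO (fun i => !u i) = fun i => !infO u i := by
  funext n
  induction n using Nat.strong_induction_on with
  | _ n ih =>
    have key : (∃ v ∈ orbit (fun i => !u i), (∀ i, i < n → v i = lexSupSeq (orbit fun i => !u i) i) ∧
        v n = true) ↔
        ∃ v ∈ orbit u, (∀ i, i < n → v i = lexInfSeq (orbit u) i) ∧ v n = false := by
      constructor
      · rintro ⟨_, ⟨k, rfl⟩, h1, h2⟩
        refine ⟨_, ⟨k, rfl⟩, fun i hi => ?_, by simpa using h2⟩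
        have h3 := h1 i hi
        have h4 := ih i hi
        simp only [supO, infO] at h4
        rw [h4] at h3
        simpa using h3
      · rintro ⟨_, ⟨k, rfl⟩, h1, h2⟩
        refine ⟨_, ⟨k, rfl⟩, fun i hi => ?_, by simpa using h2⟩
        have h3 := h1 i hi
        have h4 := ih i hi
        simp only [supO, infO] at h4
        rw [h4, ← h3]
    rw [supO, infO, lexSupSeq, lexInfSeq]
    by_cases h : ∃ v ∈ orbit u, (∀ i, i < n → v i = lexInfSeq (orbit u) i) ∧ v n = false
    · rw [decide_eq_true (key.mpr h), decide_eq_false (not_not.mpr h)]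
      rfl
    · rw [decide_eq_false (mt key.mp h), decide_eq_true h]
      rfl

theorem hasSum_inv_pow_succ {β : ℝ} (hβ : 1 < β) :
    HasSum (fun k : ℕ => 1 / β ^ (k + 1)) (1 / (β - 1)) := by
  have h0 : β ≠ 0 := by positivity
  have h1 : β - 1 ≠ 0 := by linarith
  have h := (hasSum_geometric_of_lt_one (r := β⁻¹) (by positivity)
    (inv_lt_one_of_one_lt₀ hβ)).mul_left β⁻¹
  have e1 : (fun k : ℕ => 1 / β ^ (k + 1)) = fun k => β⁻¹ * β⁻¹ ^ k := by
    funext k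
    rw [← pow_succ', inv_pow, one_div]
  have e2 : 1 / (β - 1) = β⁻¹ * (1 - β⁻¹)⁻¹ := by
    rw [← mul_inv, mul_sub, mul_inv_cancel₀ h0, mul_one, one_div]
  rw [e1, e2]
  exact h

theorem digit_div_pow_nonneg {β : ℝ} (hβ : 0 ≤ β) (v : ℕ → Bool) (k : ℕ) :
    0 ≤ (if v k then (1 : ℝ) else 0) / β ^ (k + 1) := by
  split_ifs <;> positivity

theorem digit_div_pow_le {β : ℝ} (hβ : 0 ≤ β) (v : ℕ → Bool) (k : ℕ) :
    (if v k then (1 : ℝ) else 0) / β ^ (k + 1) ≤ 1 / β ^ (k + 1) := by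
  gcongr
  split_ifs <;> norm_num

theorem summable_digit_div_pow {β : ℝ} (hβ : 1 < β) (v : ℕ → Bool) :
    Summable fun k : ℕ => (if v k then (1 : ℝ) else 0) / β ^ (k + 1) :=
  (hasSum_inv_pow_succ hβ).summable.of_nonneg_of_le
    (digit_div_pow_nonneg (by linarith) v) (digit_div_pow_le (by linarith) v)

theorem piB_nonneg {β : ℝ} (hβ : 0 ≤ β) (v : ℕ → Bool) : 0 ≤ piB β v :=
  tsum_nonneg (digit_div_pow_nonneg hβ v)

theorem piB_le {β : ℝ} (hβ : 1 < β) (v : ℕ → Bool) : piB β v ≤ 1 / (β - 1) := by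
  rw [← (hasSum_inv_pow_succ hβ).tsum_eq]
  exact (summable_digit_div_pow hβ v).tsum_le_tsum (digit_div_pow_le (by linarith) v)
    (hasSum_inv_pow_succ hβ).summable

theorem piB_lt {β : ℝ} (hβ : 1 < β) {v : ℕ → Bool} {k : ℕ} (hk : v k = false) :
    piB β v < 1 / (β - 1) := by
  rw [← (hasSum_inv_pow_succ hβ).tsum_eq]
  refine Summable.tsum_lt_tsum (i := k) (digit_div_pow_le (by linarith) v) ?_
    (summable_digit_div_pow hβ v) (hasSum_inv_pow_succ hβ).summable
  simp only [hk, Bool.false_eq_true, if_false, zero_div]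
  positivity

theorem piB_add_piB_not {β : ℝ} (hβ : 1 < β) (v : ℕ → Bool) :
    piB β v + piB β (fun i => !v i) = 1 / (β - 1) := by
  rw [piB, piB, ← (summable_digit_div_pow hβ v).tsum_add
    (summable_digit_div_pow hβ fun i => !v i), ← (hasSum_inv_pow_succ hβ).tsum_eq]
  congr 1
  funext k
  cases v k <;> simp

theorem mul_piB_eq {β : ℝ} (hβ : 1 < β) (v : ℕ → Bool) :
    β * piB β v = (if v 0 then 1 else 0) + piB β fun i => v (i + 1) := by
  have h0 : β ≠ 0 := by positivity
  rw [piB, (summable_digit_div_pow hβ v).tsum_eq_zero_add, mul_add, ← tsum_mul_left, piB]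
  congr 1
  · rw [zero_add, pow_one, mul_div_cancel₀ _ h0]
  · congr 1
    funext k
    rw [pow_succ' β (k + 1)]
    field_simp

theorem piB_le_piB_of_le {β γ : ℝ} (hβ : 1 < β) (h : β ≤ γ) (v : ℕ → Bool) :
    piB γ v ≤ piB β v := by
  refine (summable_digit_div_pow (by linarith) v).tsum_le_tsum (fun k => ?_)
    (summable_digit_div_pow hβ v)
  have : (0 : ℝ) ≤ if v k then 1 else 0 := by split_ifs <;> norm_num
  gcongr

/-- Also valid at `β = 1`, provided the series converges there. -/
theorem mul_piB_le_mul_piB {β γ : ℝ} (hβ : 1 ≤ β) (h : β ≤ γ) (hγ : 1 < γ) (v : ℕ → Bool)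
    (hv : Summable fun k : ℕ => (if v k then (1 : ℝ) else 0) / β ^ (k + 1)) :
    γ * piB γ v ≤ β * piB β v := by
  rw [piB, piB, ← tsum_mul_left, ← tsum_mul_left]
  refine ((summable_digit_div_pow hγ v).mul_left γ).tsum_le_tsum (fun k => ?_) (hv.mul_left β)
  have h0 : (0 : ℝ) ≤ if v k then 1 else 0 := by split_ifs <;> norm_num
  have hβ0 : β ≠ 0 := by positivity
  have hγ0 : γ ≠ 0 := by positivity
  have e : ∀ x : ℝ, x ≠ 0 → x * ((if v k then (1 : ℝ) else 0) / x ^ (k + 1)) =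
      (if v k then (1 : ℝ) else 0) / x ^ k := by
    intro x hx
    rw [pow_succ']
    field_simp
  rw [e β hβ0, e γ hγ0]
  gcongr

theorem continuousOn_piB {b : ℝ} (hb : 1 < b) (v : ℕ → Bool) :
    ContinuousOn (fun β => piB β v) (Set.Ici b) := by
  unfold piB
  refine continuousOn_tsum (u := fun k => 1 / b ^ (k + 1)) (fun k => ?_)
    (hasSum_inv_pow_succ hb).summable (fun k x hx => ?_)
  · refine continuousOn_const.div (continuousOn_id.pow _) fun x hx => ?_
    have : 0 < x := by linarith [Set.mem_Ici.mp hx]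
    exact pow_ne_zero _ this.ne'
  · have hx' : b ≤ x := hx
    have hx0 : 0 ≤ x := by linarith
    rw [Real.norm_of_nonneg (digit_div_pow_nonneg hx0 v k)]
    refine (digit_div_pow_le hx0 v k).trans ?_
    gcongr

theorem mul_piB_injective {β γ m : ℝ} (hm : 1 < m) (hβ : 1 < β) (hγ : 1 < γ) {v : ℕ → Bool}
    (h1 : β * piB β v = m) (h2 : γ * piB γ v = m) : β = γ := by
  wlog h : β < γ generalizing β γ
  · rcases eq_or_lt_of_le (not_lt.mp h) with h | h
    · exact h.symm
    · exact (this hγ hβ h2 h1 h).symm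
  exfalso
  rw [mul_piB_eq hβ] at h1
  rw [mul_piB_eq hγ] at h2
  have h3 := mul_piB_le_mul_piB hβ.le h.le hγ _ (summable_digit_div_pow hβ fun i => v (i + 1))
  have h4 : (if v 0 then (1 : ℝ) else 0) ≤ 1 := by split_ifs <;> norm_num
  have h5 : piB β (fun i => v (i + 1)) = piB γ fun i => v (i + 1) := by linarith
  rw [h5] at h3
  nlinarith

theorem piB_lt_piB_of_agrees {β : ℝ} (hβ : 2 ≤ β) (n : ℕ) {x y : ℕ → Bool}
    (h : ∀ i, i < n → x i = y i) (hx : x n = false) (hy : y n = true)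
    (hk : ∃ k, n < k ∧ x k = false) : piB β x < piB β y := by
  have hβ1 : 1 < β := by linarith
  refine lt_of_mul_lt_mul_left (a := β) ?_ (by linarith)
  induction n generalizing x y with
  | zero =>
    obtain ⟨k, hk, hxk⟩ := hk
    obtain ⟨k, rfl⟩ : ∃ j, k = j + 1 := ⟨k - 1, by omega⟩
    rw [mul_piB_eq hβ1, mul_piB_eq hβ1, hx, hy]
    have h1 := piB_lt hβ1 (v := fun i => x (i + 1)) hxk
    have h2 : 1 / (β - 1) ≤ 1 := by
      rw [div_le_one (by linarith)]
      linarith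
    have h3 := piB_nonneg (β := β) (by linarith) fun i => y (i + 1)
    simp only [Bool.false_eq_true, if_false, if_true]
    linarith
  | succ n ih =>
    rw [mul_piB_eq hβ1, mul_piB_eq hβ1, h 0 (by omega)]
    obtain ⟨k, hk, hxk⟩ := hk
    obtain ⟨k, rfl⟩ : ∃ j, k = j + 1 := ⟨k - 1, by omega⟩
    have := ih (x := fun i => x (i + 1)) (y := fun i => y (i + 1))
      (fun i hi => h (i + 1) (by omega)) hx hy ⟨k, by omega, hxk⟩
    have := lt_of_mul_lt_mul_left this (by linarith)
    linarith

theorem piB_supO_lt {β : ℝ} (hβ : 2 ≤ β) {u u' : ℕ → Bool} (h : lexLt (supO u) (supO u')) :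
    piB β (supO u) < piB β (supO u') := by
  obtain ⟨n, hn, hlt⟩ := h
  obtain ⟨hx, hy⟩ := Bool.lt_iff.mp hlt
  refine piB_lt_piB_of_agrees hβ n hn hx hy ?_
  by_contra! hk
  have := supO_eq_true_of_eventually (u := u) (N := n) (fun k hk' => by simpa using hk k hk') n
  simp [hx] at this

theorem nonempty_of_two_le_sInf {S : Set ℝ} (h : 2 ≤ sInf S) : S.Nonempty := by
  by_contra hS
  rw [Set.not_nonempty_iff_eq_empty.mp hS, Real.sInf_empty] at h
  norm_num at h

theorem fVal_lt_fVal_of_lexLt {m : ℝ} (hm : 1 < m) {u u' : ℕ → Bool}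
    (h : lexLt (supO u) (supO u')) (hf : 2 ≤ fVal u m) : fVal u m < fVal u' m := by
  obtain ⟨φ, hφ⟩ := nonempty_of_two_le_sInf hf
  have hbdd : ∀ v : ℕ → Bool, BddBelow {β : ℝ | 1 ≤ β ∧ β * piB β v = m} :=
    fun v => ⟨1, fun x hx => hx.1⟩
  have hle : fVal u m ≤ φ := csInf_le (hbdd _) hφ
  have hφ2 : 2 ≤ φ := hf.trans hle
  have hm' : m < φ * piB φ (supO u') := by
    rw [← hφ.2]
    exact mul_lt_mul_of_pos_left (piB_supO_lt hφ2 h) (by linarith)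
  have hgt : ∀ β, 1 ≤ β → β * piB β (supO u') = m → φ < β := by
    intro β hβ1 hβ
    by_contra! hβφ
    by_cases hs : Summable fun k : ℕ => (if supO u' k then (1 : ℝ) else 0) / β ^ (k + 1)
    · have := mul_piB_le_mul_piB hβ1 hβφ (by linarith) _ hs
      linarith
    · rw [piB, tsum_eq_zero_of_not_summable hs] at hβ
      linarith
  have hc : (fun β => β * piB β (supO u')) (φ + 1 / (m - 1)) ≤ m := by
    have hpos : 0 < 1 / (m - 1) := one_div_pos.mpr (by linarith)
    have hB : 1 < φ + 1 / (m - 1) := by linarith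
    simp only
    rw [mul_piB_eq hB]
    have h1 := piB_le hB fun i => supO u' (i + 1)
    have h2 : 1 / (φ + 1 / (m - 1) - 1) ≤ 1 / (1 / (m - 1)) :=
      one_div_le_one_div_of_le hpos (by linarith)
    rw [one_div_one_div] at h2
    have h3 : (if supO u' 0 then (1 : ℝ) else 0) ≤ 1 := by split_ifs <;> norm_num
    linarith
  have hab : φ ≤ φ + 1 / (m - 1) := by
    have : 0 < 1 / (m - 1) := one_div_pos.mpr (by linarith)
    linarith
  obtain ⟨ψ, hψ, hψm⟩ := intermediate_value_Icc' hab
    (continuousOn_id.mul ((continuousOn_piB (by linarith) (supO u')).mono Set.Icc_subset_Ici_self))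
    ⟨hc, hm'.le⟩
  have hψ1 : 1 ≤ ψ := by linarith [hψ.1]
  have heq : fVal u' m = ψ := by
    have : {β : ℝ | 1 ≤ β ∧ β * piB β (supO u') = m} = {ψ} := by
      ext β
      constructor
      · rintro ⟨h1, h2⟩
        exact mul_piB_injective hm (by linarith [hgt β h1 h2]) (by linarith [hψ.1]) h2 hψm
      · rintro rfl
        exact ⟨hψ1, hψm⟩
    rw [fVal, this, csInf_singleton]
  rw [heq]
  exact hle.trans_lt (hgt ψ hψ1 hψm)

/-- The equation defining `g_u(m)`, rewritten with a left side that strictly decreases in `β`. -/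
theorem gVal_equation_iff {β m : ℝ} (hβ : 1 < β) (u : ℕ → Bool) :
    (β - 1) * (1 + piB β (infO u)) = m ↔
      (m - 1) / (β - 1) + piB β (supO fun i => !u i) = 1 := by
  have h := piB_add_piB_not hβ (infO u)
  rw [← supO_not] at h
  have h0 : β - 1 ≠ 0 := by linarith
  have h1 : piB β (infO u) = 1 / (β - 1) - piB β (supO fun i => !u i) := by linarith
  rw [h1]
  field_simp
  constructor <;> intro h <;> linarith

theorem gVal_equation_strictAnti {m β γ : ℝ} (hm : 1 < m) (hβ : 1 < β) (h : β < γ)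
    (v : ℕ → Bool) : (m - 1) / (γ - 1) + piB γ v < (m - 1) / (β - 1) + piB β v :=
  add_lt_add_of_lt_of_le
    (div_lt_div_of_pos_left (by linarith) (by linarith) (by linarith))
    (piB_le_piB_of_le hβ h.le v)

theorem gVal_lt_gVal_of_lexLt {m : ℝ} (hm : 1 < m) {u u' : ℕ → Bool}
    (h : lexLt (infO u) (infO u')) (hg : 2 ≤ gVal u' m) : gVal u' m < gVal u m := by
  obtain ⟨γ, hγ1, hγ⟩ := nonempty_of_two_le_sInf hg
  have hle : gVal u' m ≤ γ := csInf_le ⟨1, fun x hx => hx.1.le⟩ ⟨hγ1, hγ⟩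
  have hγ2 : 2 ≤ γ := hg.trans hle
  have hlex : lexLt (supO fun i => !u' i) (supO fun i => !u i) := by
    obtain ⟨n, hn, hlt⟩ := h
    obtain ⟨hx, hy⟩ := Bool.lt_iff.mp hlt
    rw [supO_not, supO_not]
    exact ⟨n, fun i hi => by simp [hn i hi], by simp [hx, hy]⟩
  rw [gVal_equation_iff hγ1] at hγ
  have hpi := piB_supO_lt hγ2 hlex
  have hgt : 1 ≤ (m - 1) / (γ - 1) + piB γ (supO fun i => !u i) := by linarith
  have hc : (m - 1) / (γ + m - 1) + piB (γ + m) (supO fun i => !u i) ≤ 1 := by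
    have h1 := piB_le (β := γ + m) (by linarith) (supO fun i => !u i)
    have h2 : (m - 1) / (γ + m - 1) + 1 / (γ + m - 1) ≤ 1 := by
      rw [← add_div, div_le_one (by linarith)]
      linarith
    linarith
  have hcont : ContinuousOn (fun β => (m - 1) / (β - 1) + piB β (supO fun i => !u i))
      (Set.Icc γ (γ + m)) := by
    refine ContinuousOn.add (continuousOn_const.div (by fun_prop) fun x hx => ?_)
      ((continuousOn_piB hγ1 _).mono Set.Icc_subset_Ici_self)
    linarith [hx.1]
  obtain ⟨ψ, hψ, hψm⟩ := intermediate_value_Icc' (by linarith : γ ≤ γ + m) hcont ⟨hc, hgt⟩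
  simp only at hψm
  have hψ1 : 1 < ψ := by linarith [hψ.1]
  have heq : gVal u m = ψ := by
    have : {β : ℝ | 1 < β ∧ (β - 1) * (1 + piB β (infO u)) = m} = {ψ} := by
      ext β
      constructor
      · rintro ⟨h1, h2⟩
        rw [gVal_equation_iff h1] at h2
        rcases lt_trichotomy β ψ with hlt | heq | hlt
        · linarith [gVal_equation_strictAnti hm h1 hlt (supO fun i => !u i)]
        · exact heq
        · linarith [gVal_equation_strictAnti hm hψ1 hlt (supO fun i => !u i)]
      · rintro rfl
        exact ⟨hψ1, (gVal_equation_iff hψ1 u).mpr hψm⟩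
    rw [gVal, this, csInf_singleton]
  rw [heq]
  refine hle.trans_lt (lt_of_le_of_ne hψ.1 ?_)
  rintro rfl
  linarith

/-- Monotonicity of `f` and `g` with respect to the word. -/
theorem f_g_monotone_in_word (m : ℝ) (hm : m ∈ Set.Ioc (1 : ℝ) 2) (u u' : ℕ → Bool)
    (hu : TwoOnes u) (hu' : TwoOnes u') :
    (lexLt (supO u) (supO u') → 2 ≤ fVal u m → fVal u m < fVal u' m) ∧
    (lexLt (infO u) (infO u') → 2 ≤ gVal u' m → gVal u' m < gVal u m) :=
  ⟨fVal_lt_fVal_of_lexLt hm.1, gVal_lt_gVal_of_lexLt hm.1⟩
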